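/- ≲P3 ⊆ ≲CP holds if one (or more) of the following conditions holds: (1) for every set H ⊆ 𝔗_Π of literals and every set A of ground instances of rules from Δ, setting 𝔏 := 𝔗_{H ∪ A ∪ Π^G}, one has 𝔗_{𝔏 ∪ Π} ⊆ 𝔏 ∪ 𝔗_Π; (2) for each ground instance L ← L'_0 ∧ … ∧ L'_{n+1} of a rule of Π^{≥2} with L ∉ 𝔗_{Π^{<2}}, one has L'_j ∉ 𝔗_{Π^{<2}} for all j; (3) for each ground instance L ← L'_0 ∧ … ∧ L'_{n+1} of a rule of Π^{≥2}, one has L'_j ∉ 𝔗_Π for all j; (4) Π^{≥2} = ∅. -/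

import Mathlib

/-- A literal: an atom, possibly prefixed with negation. -/
inductive Lit (α : Type) : Type where
  | pos : α → Lit α
  | neg : α → Lit α
  deriving DecidableEq

/-- A (ground) rule: a head literal together with a finite (possibly empty)
conjunction of body literals.  A rule with empty body is just a literal. -/
structure Rule (α : Type) : Type where
  head : Lit α
  body : Finset (Lit α)
  deriving DecidableEq

/-- View a set of literals as a set of bodiless rules. -/
def litRules {α : Type} (S : Set (Lit α)) : Set (Rule α) :=
  {r | r.head ∈ S ∧ r.body = ∅}

/-- The theory `𝔗_P` of a set of rules `P`: the least set of literals
containing the bodiless rules of `P` and closed under the rules of `P`. -/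
inductive Th {α : Type} (P : Set (Rule α)) : Lit α → Prop where
  | step (r : Rule α) (hr : r ∈ P) (ih : ∀ l ∈ r.body, Th P l) : Th P r.head

/-- A set of rules is contradictory iff it derives both `A` and `¬A`
for some atom `A`. -/
def Contradictory {α : Type} (P : Set (Rule α)) : Prop :=
  ∃ a : α, Th P (Lit.pos a) ∧ Th P (Lit.neg a)

/-- A defeasible specification `⟨Π^F, Π^G, Δ⟩`:
facts, general (strict) rules, and defeasible rules (all taken ground). -/
structure Spec (α : Type) : Type where
  F : Set (Lit α)
  G : Set (Rule α)
  D : Set (Rule α)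

namespace Spec

variable {α : Type}

/-- `Π := Π^F ∪ Π^G`. -/
def strict (S : Spec α) : Set (Rule α) := litRules S.F ∪ S.G

/-- `𝔗_Π`. -/
def ThStrict (S : Spec α) : Set (Lit α) := {l | Th S.strict l}

/-- `𝔗_{Π ∪ Δ}`. -/
def ThAll (S : Spec α) : Set (Lit α) := {l | Th (S.strict ∪ S.D) l}

/-- `⟨A, L⟩` is an argument: `A` is a set of (ground instances of) defeasible
rules from `Δ` and `A ∪ Π` derives `L`. -/
def IsArgument (S : Spec α) (A : Set (Rule α)) (L : Lit α) : Prop :=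
  A ⊆ S.D ∧ Th (A ∪ S.strict) L

/-- `H` is a simplified activation set for `⟨A, L⟩`:  `L ∈ 𝔗_{H ∪ A ∪ Π^G}`. -/
def SAct (S : Spec α) (A : Set (Rule α)) (L : Lit α) (H : Set (Lit α)) : Prop :=
  Th (litRules H ∪ A ∪ S.G) L

/-- `H` is an activation set for `⟨A, L⟩`:
`L ∈ 𝔗_{𝔏 ∪ Π}` for some `𝔏 ⊆ 𝔗_{H ∪ A ∪ Π^G}`. -/
def Act (S : Spec α) (A : Set (Rule α)) (L : Lit α) (H : Set (Lit α)) : Prop :=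
  ∃ Ls : Set (Lit α), Ls ⊆ {l | Th (litRules H ∪ A ∪ S.G) l} ∧
    Th (litRules Ls ∪ S.strict) L

/-- `H` is a minimal simplified activation set for `⟨A, L⟩`. -/
def MinSAct (S : Spec α) (A : Set (Rule α)) (L : Lit α) (H : Set (Lit α)) : Prop :=
  S.SAct A L H ∧ ∀ H' ⊂ H, ¬ S.SAct A L H'

/-- `H` is a minimal activation set for `⟨A, L⟩`. -/
def MinAct (S : Spec α) (A : Set (Rule α)) (L : Lit α) (H : Set (Lit α)) : Prop :=
  S.Act A L H ∧ ∀ H' ⊂ H, ¬ S.Act A L H'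

/-- Poole's original specificity relation `≲P1`. -/
def leP1 (S : Spec α) (X Y : Set (Rule α) × Lit α) : Prop :=
  S.IsArgument X.1 X.2 ∧ S.IsArgument Y.1 Y.2 ∧
    ∀ H ⊆ S.ThAll, S.SAct X.1 X.2 H → ¬ S.SAct Y.1 X.2 H → S.SAct Y.1 Y.2 H

/-- The standard version `≲P2` of Poole's specificity. -/
def leP2 (S : Spec α) (X Y : Set (Rule α) × Lit α) : Prop :=
  S.IsArgument X.1 X.2 ∧ S.IsArgument Y.1 Y.2 ∧
    ∀ H ⊆ S.ThAll, S.SAct X.1 X.2 H → ¬ S.SAct ∅ X.2 H → S.SAct Y.1 Y.2 H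

/-- The rather unflawed version `≲P3` of Poole's specificity. -/
def leP3 (S : Spec α) (X Y : Set (Rule α) × Lit α) : Prop :=
  S.IsArgument X.1 X.2 ∧ S.IsArgument Y.1 Y.2 ∧
    (Y.2 ∈ S.ThStrict → X.2 ∈ S.ThStrict) ∧
    ∀ H ⊆ S.ThAll, S.SAct X.1 X.2 H → ¬ S.SAct ∅ X.2 H → S.SAct Y.1 Y.2 H

/-- The corrected specificity relation `≲CP`. -/
def leCP (S : Spec α) (X Y : Set (Rule α) × Lit α) : Prop :=
  S.IsArgument X.1 X.2 ∧ S.IsArgument Y.1 Y.2 ∧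
    (X.2 ∈ S.ThStrict ∨
      (Y.2 ∉ S.ThStrict ∧
        ∀ H ⊆ S.ThStrict, S.Act X.1 X.2 H → S.Act Y.1 Y.2 H))

/-- `<P1 := ≲P1 \ ≳P1`. -/
def ltP1 (S : Spec α) (X Y : Set (Rule α) × Lit α) : Prop := S.leP1 X Y ∧ ¬ S.leP1 Y X
/-- `<P2 := ≲P2 \ ≳P2`. -/
def ltP2 (S : Spec α) (X Y : Set (Rule α) × Lit α) : Prop := S.leP2 X Y ∧ ¬ S.leP2 Y X
/-- `<P3 := ≲P3 \ ≳P3`. -/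
def ltP3 (S : Spec α) (X Y : Set (Rule α) × Lit α) : Prop := S.leP3 X Y ∧ ¬ S.leP3 Y X
/-- `<CP := ≲CP \ ≳CP`. -/
def ltCP (S : Spec α) (X Y : Set (Rule α) × Lit α) : Prop := S.leCP X Y ∧ ¬ S.leCP Y X

/-- `Π^{<2}`: rules of `Π` with at most one body literal. -/
def strictLt2 (S : Spec α) : Set (Rule α) := {r ∈ S.strict | r.body.card ≤ 1}

/-- `Π^{≥2}`: rules of `Π` with at least two body literals. -/
def strictGe2 (S : Spec α) : Set (Rule α) := {r ∈ S.strict | 2 ≤ r.body.card}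

/-- Condition 1 of Theorem 16. -/
def Cond1 (S : Spec α) : Prop :=
  ∀ H ⊆ S.ThStrict, ∀ A ⊆ S.D,
    {l | Th (litRules {l | Th (litRules H ∪ A ∪ S.G) l} ∪ S.strict) l} ⊆
      {l | Th (litRules H ∪ A ∪ S.G) l} ∪ S.ThStrict

/-- Condition 2 of Theorem 16. -/
def Cond2 (S : Spec α) : Prop :=
  ∀ r ∈ S.strictGe2, r.head ∉ {l | Th S.strictLt2 l} →
    ∀ l ∈ r.body, l ∉ {l | Th S.strictLt2 l}

/-- Condition 3 of Theorem 16. -/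
def Cond3 (S : Spec α) : Prop :=
  ∀ r ∈ S.strictGe2, ∀ l ∈ r.body, l ∉ S.ThStrict

/-- Condition 4 of Theorem 16. -/
def Cond4 (S : Spec α) : Prop := S.strictGe2 = ∅

end Spec

theorem Th.of_rules {α : Type} {P Q : Set (Rule α)}
    (h : ∀ r ∈ P, (∀ l ∈ r.body, Th Q l) → Th Q r.head) {l : Lit α} (hl : Th P l) : Th Q l := by
  induction hl with
  | step r hr _ ih => exact h r hr ih

theorem Th.mono {α : Type} {P Q : Set (Rule α)} (h : P ⊆ Q) {l : Lit α} (hl : Th P l) : Th Q l :=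
  hl.of_rules fun r hr => Th.step r (h hr)

theorem litRules_mono {α : Type} {s t : Set (Lit α)} (h : s ⊆ t) : litRules s ⊆ litRules t :=
  fun _ hr => ⟨h hr.1, hr.2⟩

theorem Th.of_mem_litRules {α : Type} {P : Set (Rule α)} {s : Set (Lit α)}
    (h : litRules s ⊆ P) {l : Lit α} (hl : l ∈ s) : Th P l :=
  Th.step ⟨l, ∅⟩ (h ⟨hl, rfl⟩) (by simp)

namespace Spec

variable {α : Type} {S : Spec α}

/-- Condition 1 follows from a set `T` of strict consequences that is closed under the rules of
`Π^{<2}` and meets the body of a rule of `Π^{≥2}` only if it contains the head of that rule. -/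
theorem cond1_of_closed (T : Set (Lit α)) (hT : T ⊆ S.ThStrict)
    (hlt : ∀ r ∈ S.strictLt2, (∀ l ∈ r.body, l ∈ T) → r.head ∈ T)
    (hge : ∀ r ∈ S.strictGe2, r.head ∉ T → ∀ l ∈ r.body, l ∉ T) : S.Cond1 := by
  intro H _ A _ l hl
  suffices h : Th (litRules H ∪ A ∪ S.G) l ∨ l ∈ T from h.imp_right fun h => hT h
  induction hl with
  | step r hr _ ih =>
    rcases hr with hr | hr
    · exact Or.inl hr.1
    by_cases hhead : r.head ∈ T
    · exact Or.inr hhead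
    left
    rcases Nat.lt_or_ge r.body.card 2 with hc | hc
    · have hr2 : r ∈ S.strictLt2 := ⟨hr, Nat.le_of_lt_succ hc⟩
      obtain ⟨m, hm, hmT⟩ : ∃ m ∈ r.body, m ∉ T := by
        by_contra! hall
        exact hhead (hlt r hr2 hall)
      rcases hr with hr | hr
      · simp [hr.2] at hm
      refine Th.step r (Or.inr hr) fun k hk => ?_
      rw [Finset.card_le_one.mp hr2.2 k hk m hm]
      exact (ih m hm).resolve_right hmT
    · have hbody := hge r ⟨hr, hc⟩ hhead
      rcases hr with hr | hr
      · simp [hr.2] at hc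
      exact Th.step r (Or.inr hr) fun k hk => (ih k hk).resolve_right (hbody k hk)

theorem Cond2.cond1 (h : S.Cond2) : S.Cond1 :=
  cond1_of_closed {l | Th S.strictLt2 l} (fun _ hl => Th.mono (fun _ hr => hr.1) hl)
    (fun r hr hb => Th.step r hr hb) h

theorem Cond3.cond1 (h : S.Cond3) : S.Cond1 :=
  cond1_of_closed S.ThStrict subset_rfl (fun r hr hb => Th.step r hr.1 hb)
    fun r hr _ => h r hr

theorem Cond4.cond3 (h : S.Cond4) : S.Cond3 := by
  intro r hr
  rw [h] at hr
  exact hr.elim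

theorem SAct.act {A : Set (Rule α)} {L : Lit α} {H : Set (Lit α)} (h : S.SAct A L H) :
    S.Act A L H :=
  ⟨{l | Th (litRules H ∪ A ∪ S.G) l}, subset_rfl, Th.of_mem_litRules Set.subset_union_left h⟩

theorem SAct.mem_thStrict {L : Lit α} {H : Set (Lit α)} (hH : H ⊆ S.ThStrict)
    (h : S.SAct ∅ L H) : L ∈ S.ThStrict := by
  refine Th.of_rules (fun r hr hb => ?_) h
  rcases hr with (hr | hr) | hr
  · exact hH hr.1
  · exact hr.elim
  · exact Th.step r (Or.inr hr) hb

theorem Cond1.sAct_of_act (h : S.Cond1) {A : Set (Rule α)} {L : Lit α} {H : Set (Lit α)}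
    (hA : A ⊆ S.D) (hH : H ⊆ S.ThStrict) (hL : L ∉ S.ThStrict) (hact : S.Act A L H) :
    S.SAct A L H := by
  obtain ⟨Ls, hLs, hTh⟩ := hact
  exact (h H hH A hA
    (hTh.mono (Set.union_subset_union_left _ (litRules_mono hLs)))).resolve_right hL

theorem Cond1.leCP_of_leP3 (hc : S.Cond1) {X Y : Set (Rule α) × Lit α} (h : S.leP3 X Y) :
    S.leCP X Y := by
  obtain ⟨hX, hY, hstrict, hact⟩ := h
  refine ⟨hX, hY, or_iff_not_imp_left.mpr fun hXL => ⟨mt hstrict hXL, fun H hH hXact => ?_⟩⟩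
  exact (hact H (fun _ hl => (hH hl).mono Set.subset_union_left)
    (hc.sAct_of_act hX.1 hH hXL hXact) fun h0 => hXL (h0.mem_thStrict hH)).act

end Spec

/-- Theorem 16: `≲P3 ⊆ ≲CP` holds if one (or more) of Conditions 1–4 holds. -/
theorem leP3_subset_leCP {α : Type} (S : Spec α)
    (hcond : S.Cond1 ∨ S.Cond2 ∨ S.Cond3 ∨ S.Cond4)
    (X Y : Set (Rule α) × Lit α) (h : S.leP3 X Y) : S.leCP X Y := by
  rcases hcond with hc | hc | hc | hc
  · exact hc.leCP_of_leP3 h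
  · exact hc.cond1.leCP_of_leP3 h
  · exact hc.cond1.leCP_of_leP3 h
  · exact hc.cond3.cond1.leCP_of_leP3 h
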